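/- Let Z be a possibly singular projective variety of dimension n, which may be neither irreducible nor equidimensional, embedded in ℙʳ over an algebraically closed field of characteristic zero, let Y be a proper subvariety of Z of dimension k ≥ 1, and let S be an irreducible component of maximal dimension of V₁,₃(Y,Z). If r > n + 1 and dim S = n + k, then the union of the lines belonging to S does not cover ℙʳ. -/

import Mathlib

/-!
Common framework: projective space over a field `K` with its Zariski topology,
lines, the Grassmannian `𝔾(1,n)` of lines (with the quotient Zariski topology
coming from the Stiefel-style parametrization by pairs of independent vectors),
the incidence variety `Δ(X)`, dimension of a subvariety as the topological Krull
dimension of the corresponding subspace, irreducible components, dense open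
subsets, embedded projective tangent spaces, joins and (tri)secant varieties.
-/

open MvPolynomial
open scoped LinearAlgebra.Projectivization

noncomputable section

variable (K : Type) [Field K]

/-- Projective `n`-space over `K`, with homogeneous coordinates indexed by `Fin (n+1)`. -/
abbrev Pn (n : ℕ) := ℙ K (Fin (n + 1) → K)

/-- The Zariski topology on `ℙⁿ`: generated by the basic open sets `D(f)` of
nonvanishing of homogeneous polynomials (nonvanishing of a homogeneous polynomial is
independent of the chosen representative). -/
instance projZariski (n : ℕ) : TopologicalSpace (Pn K n) :=
  TopologicalSpace.generateFrom
    {U | ∃ (f : MvPolynomial (Fin (n + 1)) K) (d : ℕ), f.IsHomogeneous d ∧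
      U = {x : Pn K n | eval x.rep f ≠ 0}}

/-- The projective linear subspace of `ℙⁿ` associated to a linear subspace `W ⊆ K^{n+1}`
(a `k`-dimensional projective linear subspace corresponds to `finrank W = k + 1`). -/
def projLinear {n : ℕ} (W : Submodule K (Fin (n + 1) → K)) : Set (Pn K n) :=
  {x | x.rep ∈ W}

/-- `l ⊆ ℙⁿ` is a (projective) line. -/
def IsLine {n : ℕ} (l : Set (Pn K n)) : Prop :=
  ∃ W : Submodule K (Fin (n + 1) → K), Module.finrank K W = 2 ∧ l = projLinear K W

/-- The Grassmannian `𝔾(1,n)` of lines in `ℙⁿ`. -/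
def Grass (n : ℕ) := {l : Set (Pn K n) // IsLine K l}

/-- Pairs of linearly independent vectors of `K^{n+1}` (parametrizing lines of `ℙⁿ`),
with the Zariski topology. -/
def Stiefel2 (n : ℕ) := {vw : Fin 2 → Fin (n + 1) → K // LinearIndependent K vw}

/-- The affine Zariski topology on the space of pairs of vectors. -/
def affZariski2 (n : ℕ) : TopologicalSpace (Fin 2 → Fin (n + 1) → K) :=
  TopologicalSpace.generateFrom
    {U | ∃ f : MvPolynomial (Fin 2 × Fin (n + 1)) K,
      U = {v | eval (fun p => v p.1 p.2) f ≠ 0}}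

instance (n : ℕ) : TopologicalSpace (Stiefel2 K n) :=
  letI := affZariski2 K n
  inferInstanceAs (TopologicalSpace {vw : Fin 2 → Fin (n + 1) → K // LinearIndependent K vw})

/-- The line of `ℙⁿ` spanned by a pair of independent vectors. -/
def lineOf {n : ℕ} (vw : Stiefel2 K n) : Grass K n :=
  ⟨projLinear K (Submodule.span K (Set.range vw.1)),
    Submodule.span K (Set.range vw.1), by rw [finrank_span_eq_card vw.2]; simp, rfl⟩

/-- The Zariski topology on the Grassmannian of lines: the quotient topology induced by the
parametrization by pairs of independent vectors. -/
instance (n : ℕ) : TopologicalSpace (Grass K n) :=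
  TopologicalSpace.coinduced (lineOf K (n := n)) inferInstance

/-- `Δ(X)`: the variety of lines incident to `X`. -/
def Delta {n : ℕ} (X : Set (Pn K n)) : Set (Grass K n) :=
  {l | (l.1 ∩ X).Nonempty}

/-- The dimension of a subvariety `S` of a (Zariski-topologized) space: the topological
Krull dimension of `S` with the subspace topology (sup of lengths of chains of irreducible
closed subsets). -/
def sdim {α : Type*} [TopologicalSpace α] (S : Set α) : WithBot ℕ∞ :=
  topologicalKrullDim S

/-- `C` is an irreducible component of `S`: a maximal irreducible closed subset of `S`. -/
def IsIrredCompOf {α : Type*} [TopologicalSpace α] (C S : Set α) : Prop :=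
  C ⊆ S ∧ IsIrreducible C ∧ IsClosed C ∧
    ∀ C' : Set α, C ⊆ C' → C' ⊆ S → IsIrreducible C' → IsClosed C' → C' = C

/-- `U` is a dense open subset of `X` (open in the subspace topology of `X`, dense in `X`). -/
def IsDenseOpenIn {α : Type*} [TopologicalSpace α] (U X : Set α) : Prop :=
  U ⊆ X ∧ (∃ V : Set α, IsOpen V ∧ U = X ∩ V) ∧ X ⊆ closure U

/-- The embedded projective tangent space of `X ⊆ ℙⁿ` at `p`: the zero locus of the
differentials at `p` of all homogeneous polynomials vanishing on `X`. -/
def tangentSpace {n : ℕ} (X : Set (Pn K n)) (p : Pn K n) : Set (Pn K n) :=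
  {y | ∀ (f : MvPolynomial (Fin (n + 1)) K) (d : ℕ), f.IsHomogeneous d →
    (∀ x ∈ X, eval x.rep f = 0) →
    (∑ i, eval p.rep (pderiv i f) * y.rep i) = 0}

/-- The line of `ℙⁿ` through two (distinct) points. -/
def lineThrough {n : ℕ} (p q : Pn K n) : Set (Pn K n) :=
  projLinear K (Submodule.span K {p.rep, q.rep})

/-- The set of lines spanned by pairs of distinct points `(p,q) ∈ Y₁ × Y₂`. -/
def joinLines {n : ℕ} (Y₁ Y₂ : Set (Pn K n)) : Set (Grass K n) :=
  {l | ∃ p ∈ Y₁, ∃ q ∈ Y₂, p ≠ q ∧ p ∈ l.1 ∧ q ∈ l.1}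

/-- The joining component of the join `J(Y₁,Y₂)`: the closure in `𝔾(1,n)` of the set of
lines spanned by pairs of distinct points of `Y₁ × Y₂`. -/
def joiningComponent {n : ℕ} (Y₁ Y₂ : Set (Pn K n)) : Set (Grass K n) :=
  closure (joinLines K Y₁ Y₂)

/-- The union of the lines belonging to a family `S ⊆ 𝔾(1,n)`. -/
def linesUnion {n : ℕ} (S : Set (Grass K n)) : Set (Pn K n) :=
  ⋃ l ∈ S, l.1

/-- `V₁,₃(Z)`: the variety of trisecant lines of `Z`, the closure in `𝔾(1,n)` of the set of
lines meeting `Z` in (at least) three pairwise distinct points. -/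
def trisecants {n : ℕ} (Z : Set (Pn K n)) : Set (Grass K n) :=
  closure {l | ∃ p ∈ Z, ∃ q ∈ Z, ∃ s ∈ Z,
    p ≠ q ∧ p ≠ s ∧ q ≠ s ∧ p ∈ l.1 ∧ q ∈ l.1 ∧ s ∈ l.1}

/-- `V₁,₃(Y,Z)`: the closure in `𝔾(1,n)` of the set of lines through a point of `Y` and two
distinct points of `Z \ Y`. -/
def trisecantsRel {n : ℕ} (Y Z : Set (Pn K n)) : Set (Grass K n) :=
  closure {l | ∃ p ∈ Y, ∃ q₁ ∈ Z \ Y, ∃ q₂ ∈ Z \ Y,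
    q₁ ≠ q₂ ∧ p ∈ l.1 ∧ q₁ ∈ l.1 ∧ q₂ ∈ l.1}

/-- `Z` has degree at least 3: some line meets `Z` in at least three (isolated) points,
i.e. the (finite) intersection with some line has at least `3` points. -/
def degreeGE3 {n : ℕ} (Z : Set (Pn K n)) : Prop :=
  ∃ l : Grass K n, (l.1 ∩ Z).Finite ∧ 3 ≤ (l.1 ∩ Z).ncard

end
theorem AlgebraicIndependent.exists_derivation {K N : Type} [Field K] [CharZero K] [Field N]
    [Algebra K N] {ι : Type} {b : ι → N} (hb : AlgebraicIndependent K b) (c : ι → N) :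
    ∃ D : Derivation K N N, ∀ i, D (b i) = c i := by
  obtain ⟨t, hst, ht⟩ := exists_isTranscendenceBasis_superset (R := K)
    (s := Set.range b) hb.coe_range
  let R := MvPolynomial t K
  let _ : Algebra R N := (MvPolynomial.aeval (fun x : t => (x : N))).toAlgebra
  have hinj : Function.Injective (algebraMap R N) := ht.1
  have : IsScalarTower K R N := IsScalarTower.of_algebraMap_eq fun x => by
    exact (AlgHom.commutes (MvPolynomial.aeval (fun x : t => (x : N))) x).symm
  have : FaithfulSMul R N := (faithfulSMul_iff_algebraMap_injective R N).2 hinj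
  let _ := FractionRing.liftAlgebra R N
  have : CharZero (FractionRing R) := charZero_of_injective_algebraMap (R := K)
    (algebraMap K (FractionRing R)).injective
  have : Algebra.IsAlgebraic R N := by
    refine (ht.isAlgebraic_iff (S := R)).2 fun i => ?_
    have : (i : N) = algebraMap R N (MvPolynomial.X i) :=
      (MvPolynomial.aeval_X (fun x : t => (x : N)) i).symm
    rw [this]
    exact isAlgebraic_algebraMap _
  have : Algebra.IsAlgebraic (FractionRing R) N :=
    (IsFractionRing.comap_isAlgebraic_iff (A := R) (K := FractionRing R) (C := N)).1 inferInstance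
  have : Algebra.FormallyEtale R (FractionRing R) :=
    Algebra.FormallyEtale.of_isLocalization (nonZeroDivisors R)
  have : Algebra.FormallyEtale (FractionRing R) N := Algebra.FormallyEtale.of_isSeparable _ _
  have : Algebra.FormallyEtale R N := Algebra.FormallyEtale.comp R (FractionRing R) N
  have hbc := KaehlerDifferential.isBaseChange_of_formallyEtale K R N
  classical
  let d : Derivation K R N := MvPolynomial.mkDerivation K
    (fun x => if h : ∃ i, b i = x then c h.choose else 0)
  let D : Derivation K N N := (hbc.lift d.liftKaehlerDifferential).compDer (KaehlerDifferential.D K N)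
  have hD : ∀ x : R, D (algebraMap R N x) = d x := by
    intro x
    have := hbc.lift_eq d.liftKaehlerDifferential (KaehlerDifferential.D K R x)
    simpa [D] using this
  refine ⟨D, fun i => ?_⟩
  have := hD (MvPolynomial.X ⟨b i, hst ⟨i, rfl⟩⟩)
  have h : ∃ j, b j = b i := ⟨i, rfl⟩
  have h2 : h.choose = i := hb.injective h.choose_spec
  have e : algebraMap R N (MvPolynomial.X ⟨b i, hst ⟨i, rfl⟩⟩) = b i := by
    change MvPolynomial.aeval _ _ = _; simp
  rw [e] at this
  rw [this]
  refine (MvPolynomial.mkDerivation_X K _ _).trans ?_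
  simp only [dif_pos h, h2]

theorem Derivation.eq_zero_of_isAlgebraic {K N : Type} [Field K] [CharZero K] [Field N]
    [Algebra K N] (D : Derivation K N N) {s : Set N} (hs : ∀ x ∈ s, D x = 0) {x : N}
    (hx : IsAlgebraic (IntermediateField.adjoin K s) x) : D x = 0 := by
  have h0 : ∀ y ∈ IntermediateField.adjoin K s, D y = 0 := by
    intro y hy
    induction hy using IntermediateField.adjoin_induction with
    | mem y hy => exact hs y hy
    | algebraMap y => simp
    | add x y _ _ hx hy => simp [hx, hy]
    | inv x _ hx => simp [hx, Derivation.leibniz_inv]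
    | mul x y _ _ hx hy => simp [hx, hy]
  set F := IntermediateField.adjoin K s
  have key := Derivation.apply_aeval_eq' (R := K) (A := F) (0 : Derivation K F N) D LinearMap.id
    (fun a => by simp [h0 a a.2]) x (minpoly F x)
  have hsep : (minpoly F x).Separable := (minpoly.irreducible hx.isIntegral).separable
  have hne := hsep.aeval_derivative_ne_zero (minpoly.aeval F x)
  have hz : (0 : Derivation K F N).mapCoeffs (minpoly F x) = 0 := by
    ext i; simp
  rw [minpoly.aeval, hz] at key
  simpa [hne] using key

theorem LinearMap.finrank_range_eq_add_of_ker_le {N M V W : Type} [Field N] [AddCommGroup M]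
    [Module N M] [AddCommGroup V] [Module N V] [AddCommGroup W] [Module N W]
    [FiniteDimensional N V] (f : M →ₗ[N] V) (g : M →ₗ[N] W)
    (h : LinearMap.ker f ≤ LinearMap.ker g) :
    Module.finrank N (LinearMap.range f) =
      Module.finrank N (LinearMap.range g) +
        Module.finrank N (Submodule.map f (LinearMap.ker g)) := by
  obtain ⟨φ, hφ⟩ := LinearMap.exists_extend
    (((LinearMap.ker f).liftQ g h).comp f.quotKerEquivRange.symm.toLinearMap)
  have hg : φ ∘ₗ f = g := by
    ext x
    have := LinearMap.congr_fun hφ ⟨f x, x, rfl⟩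
    simp only [LinearMap.comp_apply, Submodule.subtype_apply] at this
    rw [LinearMap.comp_apply, this]
    have e : f.quotKerEquivRange.symm ⟨f x, x, rfl⟩ = (LinearMap.ker f).mkQ x :=
      f.quotKerEquivRange_symm_apply_image x _
    simp [e]
  have key := LinearMap.finrank_range_add_finrank_ker (φ.domRestrict (LinearMap.range f))
  rw [LinearMap.range_domRestrict, ← LinearMap.range_comp, hg] at key
  rw [← key]
  congr 1
  refine LinearEquiv.finrank_eq ?_
  have : Submodule.map f (LinearMap.ker g) =
      Submodule.map (LinearMap.range f).subtype
        (LinearMap.ker (φ.domRestrict (LinearMap.range f))) := by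
    ext y
    simp only [Submodule.mem_map, LinearMap.mem_ker, ← hg]
    constructor
    · rintro ⟨x, hx, rfl⟩
      exact ⟨⟨f x, x, rfl⟩, hx, rfl⟩
    · rintro ⟨⟨_, x, rfl⟩, hx, rfl⟩
      exact ⟨x, hx, rfl⟩
  rw [this]
  exact Submodule.equivMapOfInjective _ (Submodule.injective_subtype _) _

/-- The derivative of a tuple of elements along derivations. -/
def Derivation.evalTuple (K : Type) {N ι : Type} [Field K] [Field N] [Algebra K N] (v : ι → N) :
    Derivation K N N →ₗ[N] (ι → N) where
  toFun D i := D (v i)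
  map_add' _ _ := rfl
  map_smul' _ _ := rfl

@[simp]
theorem Derivation.evalTuple_apply {K N ι : Type} [Field K] [Field N] [Algebra K N] (v : ι → N)
    (D : Derivation K N N) (i : ι) : Derivation.evalTuple K v D i = D (v i) := rfl

theorem AlgebraicIndependent.range_evalTuple {K N ι : Type} [Field K] [CharZero K] [Field N]
    [Algebra K N] {b : ι → N} (hb : AlgebraicIndependent K b) :
    LinearMap.range (Derivation.evalTuple K b) = ⊤ := by
  refine LinearMap.range_eq_top.2 fun c => ?_
  obtain ⟨D, hD⟩ := hb.exists_derivation c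
  exact ⟨D, funext hD⟩

theorem Derivation.finrank_evalTuple_le {K N ι κ : Type} [Field K] [CharZero K] [Field N]
    [Algebra K N] [Finite ι] [Finite κ] {b : κ → N} {v : ι → N}
    (h : ∀ D : Derivation K N N, (∀ i, D (v i) = 0) → ∀ j, D (b j) = 0) :
    Module.finrank N (LinearMap.range (Derivation.evalTuple K b)) ≤
      Module.finrank N (LinearMap.range (Derivation.evalTuple K v)) := by
  rw [LinearMap.finrank_range_eq_add_of_ker_le (Derivation.evalTuple K v)
    (Derivation.evalTuple K b)]
  · exact Nat.le_add_right _ _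
  · intro D hD
    exact funext (h D fun i => congrFun hD i)

theorem ringKrullDim_eq_of_isIntegral {R A : Type} [CommRing R] [CommRing A] [Algebra R A]
    [Algebra.IsIntegral R A] (hinj : Function.Injective (algebraMap R A)) :
    ringKrullDim A = ringKrullDim R := by
  apply le_antisymm
  · refine Order.krullDim_le_of_strictMono (PrimeSpectrum.comap (algebraMap R A)) ?_
    intro p q hpq
    exact Ideal.IsIntegral.comap_lt_comap hpq
  · refine iSup_le fun l => ?_
    obtain ⟨P, -, hP, hPo⟩ := Ideal.exists_ideal_over_prime_of_isIntegral
      l.head.asIdeal (⊥ : Ideal A) (by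
        rw [← RingHom.ker_eq_comap_bot, (RingHom.injective_iff_ker_eq_bot _).1 hinj]
        exact bot_le)
    have : P.LiesOver l.head.asIdeal := ⟨hPo.symm⟩
    obtain ⟨L, hL, -⟩ := Ideal.exists_ltSeries_of_hasGoingUp l P
    rw [← hL]
    exact Order.LTSeries.length_le_krullDim L

theorem ringKrullDim_quotient_ker_aeval {K N ι : Type} [Field K] [CharZero K] [Field N]
    [Algebra K N] [Finite ι] (g : ι → N) :
    ringKrullDim (MvPolynomial ι K ⧸ RingHom.ker (MvPolynomial.aeval (R := K) g)) =
      Module.finrank N (LinearMap.range (Derivation.evalTuple K g)) := by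
  have := Fintype.ofFinite ι
  let A := (MvPolynomial.aeval (R := K) g).range
  have hg (i) : g i ∈ A := ⟨MvPolynomial.X i, MvPolynomial.aeval_X g i⟩
  have hA : A = Algebra.adjoin K (Set.range g) := (Algebra.adjoin_range_eq_range_aeval K g).symm
  have hfg : Algebra.FiniteType K A := by
    rw [hA]
    exact (Subalgebra.fg_iff_finiteType _).1 ⟨Set.range g |>.toFinite.toFinset, by simp⟩
  obtain ⟨s, φ, hφ, hint⟩ := exists_integral_inj_algHom_of_fg K A
  let τ : Fin s → N := fun i => φ (MvPolynomial.X i)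
  have hτφ : MvPolynomial.aeval τ = A.val.comp φ := by
    ext i; simp [τ]
  have hτ : AlgebraicIndependent K τ := by
    rw [algebraicIndependent_iff_injective_aeval, hτφ]
    exact Subtype.val_injective.comp hφ
  have hdim : ringKrullDim A = s := by
    let _ : Algebra (MvPolynomial (Fin s) K) A := φ.toRingHom.toAlgebra
    have : Algebra.IsIntegral (MvPolynomial (Fin s) K) A := ⟨hint⟩
    rw [ringKrullDim_eq_of_isIntegral (R := MvPolynomial (Fin s) K) (A := A) hφ,
      MvPolynomial.ringKrullDim_of_isNoetherianRing, ringKrullDim_eq_zero_of_field]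
    simp
  have hfin : Module.finrank N (LinearMap.range (Derivation.evalTuple K τ)) = s := by
    rw [hτ.range_evalTuple, finrank_top, Module.finrank_fintype_fun_eq_card, Fintype.card_fin]
  refine (ringKrullDim_eq_of_ringEquiv
    (RingHom.quotientKerEquivRange (MvPolynomial.aeval (R := K) g).toRingHom)).trans
    (hdim.trans ?_)
  rw [← hfin]
  refine congrArg Nat.cast (le_antisymm ?_ ?_)
  · refine Derivation.finrank_evalTuple_le fun D hD j => ?_
    refine D.eq_zero_of_isAlgebraic (s := Set.range g) (by rintro _ ⟨i, rfl⟩; exact hD i) ?_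
    have : τ j ∈ IntermediateField.adjoin K (Set.range g) :=
      IntermediateField.algebra_adjoin_le_adjoin _ _ (hA ▸ (φ (MvPolynomial.X j)).2)
    exact isAlgebraic_algebraMap (⟨τ j, this⟩ : IntermediateField.adjoin K (Set.range g))
  · refine Derivation.finrank_evalTuple_le fun D hD j => ?_
    refine D.eq_zero_of_isAlgebraic (s := Set.range τ) (by rintro _ ⟨i, rfl⟩; exact hD i) ?_
    obtain ⟨p, hp, hp0⟩ := hint ⟨g j, hg j⟩
    let ψ : MvPolynomial (Fin s) K →+* IntermediateField.adjoin K (Set.range τ) :=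
      (MvPolynomial.aeval (fun i => (⟨τ i, IntermediateField.subset_adjoin _ _ ⟨i, rfl⟩⟩ :
        IntermediateField.adjoin K (Set.range τ)))).toRingHom
    have hψ : (algebraMap (IntermediateField.adjoin K (Set.range τ)) N).comp ψ =
        (A.val.comp φ).toRingHom := by
      rw [← hτφ]
      ext i
      · simp [ψ]
      · simp [ψ]
    have hI : IsIntegral (IntermediateField.adjoin K (Set.range τ)) (g j) := by
      refine ⟨p.map ψ, hp.map _, ?_⟩
      rw [Polynomial.eval₂_map, hψ]
      have := congrArg A.val hp0
      rw [map_zero] at this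
      rw [← this]
      exact (Polynomial.hom_eval₂ p φ.toRingHom A.val.toRingHom ⟨g j, hg j⟩).symm
    exact hI.isAlgebraic

/-- The topology of `T` is the Zariski topology pulled back from affine space along `e`: the closed
sets are exactly the preimages of zero loci of polynomials. -/
structure IsZariskiAlong {K T ι : Type} [Field K] [TopologicalSpace T] (e : T → ι → K) : Prop where
  isClosed_zero : ∀ f : MvPolynomial ι K, IsClosed {t | eval (e t) f = 0}
  exists_separating : ∀ C : Set T, IsClosed C → ∀ t ∉ C, ∃ f : MvPolynomial ι K,
    (∀ s ∈ C, eval (e s) f = 0) ∧ eval (e t) f ≠ 0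

namespace IsZariskiAlong

/-- The ideal of polynomials vanishing on a set of points. -/
def idealOf {K T ι : Type} [Field K] (e : T → ι → K) (C : Set T) : Ideal (MvPolynomial ι K) :=
  vanishingIdeal K (e '' C)

theorem mem_idealOf {K T ι : Type} [Field K] {e : T → ι → K} {C : Set T} {f : MvPolynomial ι K} :
    f ∈ idealOf e C ↔ ∀ t ∈ C, eval (e t) f = 0 := by
  simp [idealOf, mem_vanishingIdeal_iff]

variable {K T T' ι : Type} [Field K] [TopologicalSpace T] [TopologicalSpace T'] {e : T → ι → K}

theorem comp_isInducing (h : IsZariskiAlong e) {φ : T' → T} (hφ : Topology.IsInducing φ) :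
    IsZariskiAlong (e ∘ φ) where
  isClosed_zero f := (h.isClosed_zero f).preimage hφ.continuous
  exists_separating C hC t ht := by
    obtain ⟨D, hD, rfl⟩ := hφ.isClosed_iff.1 hC
    obtain ⟨f, hf, hft⟩ := h.exists_separating D hD (φ t) ht
    exact ⟨f, fun s hs => hf _ hs, hft⟩

theorem idealOf_strictAnti (h : IsZariskiAlong e) {C D : Set T} (hC : IsClosed C) (hCD : C ⊂ D) :
    idealOf e D < idealOf e C := by
  refine lt_of_le_of_ne (fun f hf => mem_idealOf.2 fun t ht => mem_idealOf.1 hf t (hCD.1 ht)) ?_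
  intro heq
  obtain ⟨t, htD, htC⟩ := Set.exists_of_ssubset hCD
  obtain ⟨f, hf, hft⟩ := h.exists_separating C hC t htC
  exact hft (mem_idealOf.1 (heq ▸ mem_idealOf.2 hf : f ∈ idealOf e D) t htD)

theorem noetherianSpace [Finite ι] (h : IsZariskiAlong e) : TopologicalSpace.NoetherianSpace T := by
  have : StrictMono fun U : TopologicalSpace.Opens T => idealOf e (U : Set T)ᶜ := by
    intro U V hUV
    exact h.idealOf_strictAnti V.isOpen.isClosed_compl (compl_lt_compl_iff_lt.2 hUV)
  exact this.wellFoundedGT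

theorem isPrime_idealOf (h : IsZariskiAlong e) {C : Set T} (hC : IsIrreducible C) :
    (idealOf e C).IsPrime := by
  refine ⟨?_, ?_⟩
  · rw [Ideal.ne_top_iff_one, mem_idealOf]
    obtain ⟨t, ht⟩ := hC.1
    intro h1
    simpa using h1 t ht
  · intro f g hfg
    rw [mem_idealOf] at hfg
    have := isPreirreducible_iff_isClosed_union_isClosed.1 hC.2 _ _ (h.isClosed_zero f)
      (h.isClosed_zero g) (fun t ht => by simpa using hfg t ht)
    exact this.imp (fun H => mem_idealOf.2 H) (fun H => mem_idealOf.2 H)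

theorem topologicalKrullDim_le (h : IsZariskiAlong e) (J : Ideal (MvPolynomial ι K))
    (hJ : ∀ f ∈ J, ∀ t, eval (e t) f = 0) :
    topologicalKrullDim T ≤ ringKrullDim (MvPolynomial ι K ⧸ J) := by
  have hJle (C : Set T) : J ≤ idealOf e C := fun f hf => mem_idealOf.2 fun t _ => hJ f hf t
  have hker : RingHom.ker (Ideal.Quotient.mk J) = J := Ideal.mk_ker
  have hsurj : Function.Surjective (Ideal.Quotient.mk J) := Ideal.Quotient.mk_surjective
  have hcomap (C : Set T) : ((idealOf e C).map (Ideal.Quotient.mk J)).comap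
      (Ideal.Quotient.mk J) = idealOf e C := by
    rw [Ideal.comap_map_of_surjective _ hsurj, ← RingHom.ker_eq_comap_bot, hker,
      sup_eq_left.2 (hJle C)]
  have hmono : StrictMono (fun C : TopologicalSpace.IrreducibleCloseds T => OrderDual.toDual
      (⟨(idealOf e (C : Set T)).map (Ideal.Quotient.mk J), by
        have := h.isPrime_idealOf C.isIrreducible'
        exact Ideal.map_isPrime_of_surjective hsurj (by rw [hker]; exact hJle _)⟩ :
        PrimeSpectrum (MvPolynomial ι K ⧸ J))) := by
    intro C D hCD
    have hlt := h.idealOf_strictAnti C.isClosed' hCD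
    refine OrderDual.toDual_lt_toDual.2 (lt_of_le_of_ne (Ideal.map_mono hlt.le) fun heq => ?_)
    have := congrArg (fun p => Ideal.comap (Ideal.Quotient.mk J) (PrimeSpectrum.asIdeal p)) heq
    simp only [hcomap] at this
    exact hlt.ne this
  have := Order.krullDim_le_of_strictMono _ hmono
  rwa [Order.krullDim_orderDual] at this

theorem le_topologicalKrullDim [IsAlgClosed K] [Finite ι] (h : IsZariskiAlong e)
    (J : Ideal (MvPolynomial ι K))
    (hJ : ∀ y : ι → K, (∀ f ∈ J, eval y f = 0) → ∃ t, e t = y) :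
    ringKrullDim (MvPolynomial ι K ⧸ J) ≤ topologicalKrullDim T := by
  let Q (p : PrimeSpectrum (MvPolynomial ι K ⧸ J)) : Ideal (MvPolynomial ι K) :=
    p.asIdeal.comap (Ideal.Quotient.mk J)
  have hQJ (p) : J ≤ Q p := fun f hf => by
    simp [Q, Ideal.mem_comap, Ideal.Quotient.eq_zero_iff_mem.2 hf]
  let V (p : PrimeSpectrum (MvPolynomial ι K ⧸ J)) : Set T := {t | ∀ f ∈ Q p, eval (e t) f = 0}
  have hV (p) : idealOf e (V p) = Q p := by
    refine le_antisymm (fun f hf => ?_) fun f hf => mem_idealOf.2 fun t ht => ht f hf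
    have hp : (Q p).IsPrime := Ideal.comap_isPrime _ _
    rw [← IsPrime.vanishingIdeal_zeroLocus (K := K) (Q p), mem_vanishingIdeal_iff]
    intro y hy
    have hy' : ∀ f ∈ Q p, eval y f = 0 := fun f hf => by
      simpa [coe_aeval_eq_eval] using hy f hf
    obtain ⟨t, rfl⟩ := hJ y fun f hf => hy' f (hQJ p hf)
    simpa [coe_aeval_eq_eval] using mem_idealOf.1 hf t hy'
  have hclosed (p) : IsClosed (V p) := by
    have : V p = ⋂ f ∈ Q p, {t | eval (e t) f = 0} := by ext t; simp [V]
    rw [this]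
    exact isClosed_biInter fun f _ => h.isClosed_zero f
  have hirr (p) : IsIrreducible (V p) := by
    have hp : (Q p).IsPrime := Ideal.comap_isPrime _ _
    refine ⟨?_, isPreirreducible_iff_isClosed_union_isClosed.2 ?_⟩
    · by_contra hne
      rw [Set.not_nonempty_iff_eq_empty] at hne
      refine hp.ne_top ((Ideal.eq_top_iff_one _).2 ?_)
      rw [← hV p, hne, mem_idealOf]
      simp
    · intro C D hC hD hCD
      by_contra! hcon
      obtain ⟨⟨s, hs, hsC⟩, ⟨t, ht, htD⟩⟩ :=
        And.intro (Set.not_subset.1 hcon.1) (Set.not_subset.1 hcon.2)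
      obtain ⟨f, hf, hfs⟩ := h.exists_separating C hC s hsC
      obtain ⟨g, hg, hgt⟩ := h.exists_separating D hD t htD
      have hfg : f * g ∈ Q p := by
        rw [← hV p, mem_idealOf]
        intro u hu
        rcases hCD hu with hu | hu
        · simp [hf u hu]
        · simp [hg u hu]
      rcases hp.mem_or_mem hfg with H | H
      · exact hfs (hs f H)
      · exact hgt (ht g H)
  have hmono : StrictMono (fun p : (PrimeSpectrum (MvPolynomial ι K ⧸ J))ᵒᵈ =>
      (⟨V (OrderDual.ofDual p), hirr _, hclosed _⟩ : TopologicalSpace.IrreducibleCloseds T)) := by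
    intro p q hpq
    have hpq' : OrderDual.ofDual q < OrderDual.ofDual p := hpq
    refine lt_of_le_of_ne (fun t ht f hf => ht f (Ideal.comap_mono hpq'.le hf)) fun heq => ?_
    have h1 : V (OrderDual.ofDual p) = V (OrderDual.ofDual q) :=
      congrArg TopologicalSpace.IrreducibleCloseds.carrier heq
    have h2 : Q (OrderDual.ofDual p) = Q (OrderDual.ofDual q) := by rw [← hV, h1, hV]
    refine hpq'.ne (PrimeSpectrum.ext ?_).symm
    exact Ideal.comap_injective_of_surjective _ Ideal.Quotient.mk_surjective h2
  have := Order.krullDim_le_of_strictMono _ hmono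
  rwa [Order.krullDim_orderDual] at this

end IsZariskiAlong

theorem isZariskiAlong_affZariski2 (K : Type) [Field K] (n : ℕ) :
    let _ := affZariski2 K n
    IsZariskiAlong (fun (v : Fin 2 → Fin (n + 1) → K) (p : Fin 2 × Fin (n + 1)) => v p.1 p.2) := by
  intro τ
  have hbasis := TopologicalSpace.isTopologicalBasis_of_subbasis_of_inter (t := τ) rfl (by
    rintro _ ⟨f, rfl⟩ _ ⟨g, rfl⟩
    exact ⟨f * g, by ext v; simp⟩)
  refine ⟨fun f => ⟨TopologicalSpace.isOpen_generateFrom_of_mem ⟨f, rfl⟩⟩, fun C hC t ht => ?_⟩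
  obtain ⟨U, hU, htU, hUC⟩ := hbasis.exists_subset_of_mem_open (show t ∈ Cᶜ from ht) hC.isOpen_compl
  rcases hU with rfl | ⟨f, rfl⟩
  · exact ⟨1, fun s hs => absurd hs (hUC trivial), by simp⟩
  · exact ⟨f, fun s hs => by_contra fun h => hUC h hs, htU⟩

theorem isZariskiAlong_stiefel2 (K : Type) [Field K] (n : ℕ) :
    IsZariskiAlong (fun (v : Stiefel2 K n) (p : Fin 2 × Fin (n + 1)) => v.1 p.1 p.2) := by
  let _ := affZariski2 K n
  have hind : Topology.IsInducing (fun v : Stiefel2 K n => v.1) := Topology.IsInducing.subtypeVal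
  exact (isZariskiAlong_affZariski2 K n).comp_isInducing hind

theorem aeval_mul_of_isHomogeneous {K N ι : Type} [CommRing K] [CommRing N] [Algebra K N]
    {F : MvPolynomial ι K} {d : ℕ} (hF : F.IsHomogeneous d) (a : N) (v : ι → N) :
    aeval (fun i => a * v i) F = a ^ d * aeval v F := by
  simp only [aeval_def, eval₂_eq, Finset.mul_sum]
  refine Finset.sum_congr rfl fun m hm => ?_
  have hd : ∑ i ∈ m.support, m i = d := by
    have := hF (mem_support_iff.1 hm)
    rw [← this]
    exact DFunLike.congr_fun (F := (ι →₀ ℕ) →+ ℕ) Finsupp.degree_eq_weight_one m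
  simp only [mul_pow, Finset.prod_mul_distrib, Finset.prod_pow_eq_pow_sum, hd]
  ring

theorem eval_rep_mk_eq_zero_iff {K : Type} [Field K] {n : ℕ} {F : MvPolynomial (Fin (n + 1)) K}
    {d : ℕ} (hF : F.IsHomogeneous d) (v : Fin (n + 1) → K) (hv : v ≠ 0) :
    eval (Projectivization.mk K v hv).rep F = 0 ↔ eval v F = 0 := by
  obtain ⟨a, ha⟩ := Projectivization.exists_smul_eq_mk_rep K v hv
  rw [← ha]
  have := aeval_mul_of_isHomogeneous hF (a : K) v
  change eval (fun i => (a : K) * v i) F = 0 ↔ _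
  rw [← coe_aeval_eq_eval, ← coe_aeval_eq_eval]
  change aeval _ F = 0 ↔ aeval _ F = 0
  rw [this]
  simp

theorem exists_homogeneous_separating {K : Type} [Field K] {n : ℕ} {C : Set (Pn K n)}
    (hC : IsClosed C) {x : Pn K n} (hx : x ∉ C) :
    ∃ (F : MvPolynomial (Fin (n + 1)) K) (d : ℕ), F.IsHomogeneous d ∧
      (∀ y ∈ C, eval y.rep F = 0) ∧ eval x.rep F ≠ 0 := by
  have hbasis := TopologicalSpace.isTopologicalBasis_of_subbasis_of_inter
    (t := projZariski K n) rfl (by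
    rintro _ ⟨f, d, hf, rfl⟩ _ ⟨g, e, hg, rfl⟩
    exact ⟨f * g, d + e, hf.mul hg, by ext v; simp⟩)
  obtain ⟨U, hU, htU, hUC⟩ := hbasis.exists_subset_of_mem_open (show x ∈ Cᶜ from hx) hC.isOpen_compl
  rcases hU with rfl | ⟨f, d, hf, rfl⟩
  · exact ⟨1, 0, isHomogeneous_one _ _, fun s hs => absurd hs (hUC trivial), by simp⟩
  · exact ⟨f, d, hf, fun s hs => by_contra fun h => hUC h hs, htU⟩

theorem isClosed_zero_of_isHomogeneous {K : Type} [Field K] {n : ℕ}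
    {F : MvPolynomial (Fin (n + 1)) K} {d : ℕ} (hF : F.IsHomogeneous d) :
    IsClosed {x : Pn K n | eval x.rep F = 0} :=
  ⟨TopologicalSpace.isOpen_generateFrom_of_mem ⟨F, d, hF, rfl⟩⟩

theorem exists_isHomogeneous_eval_eq {K : Type} [Field K] {n : ℕ} (i : Fin (n + 1))
    (f : MvPolynomial (Fin (n + 1)) K) :
    ∃ (F : MvPolynomial (Fin (n + 1)) K) (d : ℕ), F.IsHomogeneous d ∧
      ∀ y : Fin (n + 1) → K, y i = 1 → eval y F = eval y f := by
  refine ⟨∑ d ∈ Finset.range (f.totalDegree + 1),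
    X i ^ (f.totalDegree - d) * homogeneousComponent d f, f.totalDegree, ?_, ?_⟩
  · refine IsHomogeneous.sum _ _ _ fun d hd => ?_
    have h := (isHomogeneous_X_pow (R := K) i (f.totalDegree - d)).mul
      (homogeneousComponent_isHomogeneous d f)
    rwa [Nat.sub_add_cancel (by simpa [Nat.lt_succ_iff] using hd)] at h
  · intro y hy
    conv_rhs => rw [← sum_homogeneousComponent f]
    simp [hy]

/-- The points of a projective set lying in the affine chart `y i = 1`. -/
theorem isZariskiAlong_chart {K : Type} [Field K] {n : ℕ} (i : Fin (n + 1)) (Z : Set (Pn K n))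
    (T : Type) [TopologicalSpace T] (e : T → Fin (n + 1) → K) (he : ∀ t, e t i = 1)
    (he0 : ∀ t, e t ≠ 0) (φ : T → Z) (hφ : Topology.IsInducing φ)
    (hφe : ∀ t, (φ t : Pn K n) = Projectivization.mk K (e t) (he0 t)) :
    IsZariskiAlong e where
  isClosed_zero f := by
    obtain ⟨F, d, hF, hFf⟩ := exists_isHomogeneous_eval_eq i f
    convert! (isClosed_zero_of_isHomogeneous hF).preimage
      (continuous_subtype_val.comp hφ.continuous) using 1
    ext t
    simp only [Set.mem_ofPred_eq, Set.mem_preimage, Function.comp_apply, hφe]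
    rw [eval_rep_mk_eq_zero_iff hF, hFf _ (he t)]
  exists_separating C hC t ht := by
    obtain ⟨D, hD, rfl⟩ := (Topology.IsInducing.subtypeVal.comp hφ).isClosed_iff.1 hC
    obtain ⟨F, d, hF, hF0, hFt⟩ := exists_homogeneous_separating hD ht
    refine ⟨F, fun s hs => ?_, ?_⟩
    · have := hF0 _ hs
      simp only [Function.comp_apply, hφe] at this
      rwa [eval_rep_mk_eq_zero_iff hF] at this
    · simp only [Function.comp_apply, hφe] at hFt
      rwa [Ne, eval_rep_mk_eq_zero_iff hF] at hFt

theorem finrank_evalTuple_le_of_sdim_le {K N : Type} [Field K] [IsAlgClosed K] [CharZero K]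
    [Field N] [Algebra K N] {r m : ℕ} {Z : Set (Pn K r)} (hZ : IsClosed Z)
    (hdim : sdim Z ≤ (m : WithBot ℕ∞)) (ζ : Fin (r + 1) → N) (hζ : ζ ≠ 0)
    (H : ∀ (F : MvPolynomial (Fin (r + 1)) K) (d : ℕ), F.IsHomogeneous d →
      (∀ x ∈ Z, eval x.rep F = 0) → aeval ζ F = 0) :
    Module.finrank N (LinearMap.range (Derivation.evalTuple K ζ)) ≤ m + 1 := by
  obtain ⟨i, hi⟩ := Function.ne_iff.1 hζ
  rw [Pi.zero_apply] at hi
  let g : Fin (r + 1) → N := fun j => ζ j / ζ i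
  have hg (j) : ζ j = ζ i * g j := by simp only [g]; field_simp
  have hD (D : Derivation K N N) (j) : D (ζ j) = ζ i * D (g j) + g j * D (ζ i) := by
    conv_lhs => rw [hg j, D.leibniz]
    simp
  let J := RingHom.ker (aeval (R := K) g)
  let T := {y : Fin (r + 1) → K // y i = 1 ∧ ∃ h : y ≠ 0, Projectivization.mk K y h ∈ Z}
  let φ : T → Z := fun y => ⟨Projectivization.mk K y.1 y.2.2.1, y.2.2.2⟩
  let _ : TopologicalSpace T := TopologicalSpace.induced φ inferInstance
  have hφ : Topology.IsInducing φ := ⟨rfl⟩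
  have hzar : IsZariskiAlong (fun y : T => y.1) :=
    isZariskiAlong_chart i Z T _ (fun y => y.2.1) (fun y => y.2.2.1) φ hφ fun _ => rfl
  have hTg : Module.finrank N (LinearMap.range (Derivation.evalTuple K g)) ≤ m := by
    have h1 := hzar.le_topologicalKrullDim J (by
      intro y hy
      have hyi : y i = 1 := by
        have := hy (X i - 1) (by simp [J, RingHom.mem_ker, g, hi])
        simpa [sub_eq_zero] using this
      have hy0 : y ≠ 0 := fun h => by simp [h] at hyi
      refine ⟨⟨y, hyi, hy0, ?_⟩, rfl⟩
      by_contra hyZ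
      obtain ⟨F, d, hF, hFZ, hFy⟩ := exists_homogeneous_separating hZ hyZ
      rw [Ne, eval_rep_mk_eq_zero_iff hF] at hFy
      refine hFy (hy F ?_)
      have h2 := aeval_mul_of_isHomogeneous hF (ζ i)⁻¹ ζ
      rw [H F d hF hFZ, mul_zero] at h2
      rw [RingHom.mem_ker, ← h2]
      congr 1
      congr 1
      ext j
      simp only [g]
      rw [mul_comm, div_eq_mul_inv])
    have h2 : (Module.finrank N (LinearMap.range (Derivation.evalTuple K g)) : WithBot ℕ∞) ≤ m :=
      (ringKrullDim_quotient_ker_aeval g).symm.le.trans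
        (h1.trans (hφ.topologicalKrullDim_le.trans hdim))
    exact_mod_cast h2
  rw [LinearMap.finrank_range_eq_add_of_ker_le (Derivation.evalTuple K ζ)
    (Derivation.evalTuple K g)]
  · refine Nat.add_le_add hTg ?_
    refine (Submodule.finrank_mono (t := Submodule.span N {ζ}) ?_).trans
      (finrank_span_singleton hζ).le
    rintro _ ⟨D, hDg, rfl⟩
    rw [Submodule.mem_span_singleton]
    refine ⟨D (ζ i) / ζ i, ?_⟩
    ext j
    have h0 : D (g j) = 0 := congrFun hDg j
    simp only [Pi.smul_apply, smul_eq_mul, Derivation.evalTuple_apply]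
    rw [hD D j, h0]
    simp only [g]
    field_simp
    simp
  · intro D hDζ
    have h0 (j) : D (ζ j) = 0 := congrFun hDζ j
    ext j
    have := hD D j
    rw [h0, h0] at this
    simpa [hi] using this.symm

theorem exists_le_topologicalKrullDim_of_isOpenEmbedding {X I : Type} [TopologicalSpace X]
    {A : I → Type} [∀ i, TopologicalSpace (A i)] (σ : ∀ i, A i → X)
    (hσ : ∀ i, Topology.IsOpenEmbedding (σ i)) (hcover : ∀ x, ∃ i, x ∈ Set.range (σ i)) (d : ℕ)
    (hd : (d : WithBot ℕ∞) ≤ topologicalKrullDim X) :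
    ∃ i, (d : WithBot ℕ∞) ≤ topologicalKrullDim (A i) := by
  obtain ⟨l, hl⟩ := Order.le_krullDim_iff.1 hd
  obtain ⟨x, hx⟩ := l.head.isIrreducible'.1
  obtain ⟨i, y, rfl⟩ := hcover x
  refine ⟨i, ?_⟩
  let e := TopologicalSpace.IrreducibleCloseds.orderIsoOfIsOpenEmbedding (σ i) (hσ i)
  let C := e.symm ⟨l.head, ⟨y, hx⟩⟩
  have hC : TopologicalSpace.IrreducibleCloseds.map (σ i) (hσ i).continuous C = l.head :=
    congrArg Subtype.val (e.apply_symm_apply ⟨l.head, ⟨y, hx⟩⟩)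
  have h1 := (hσ i).coheight_map C
  rw [hC] at h1
  have h2 : (d : ℕ∞) ≤ Order.coheight C := by
    rw [← h1, ← hl]
    exact Order.length_le_coheight_head
  exact (WithBot.coe_le_coe.2 h2).trans (Order.coheight_le_krullDim C)

theorem IsZariskiAlong.continuous_of {K T T' ι : Type} [Field K] [TopologicalSpace T]
    [TopologicalSpace T'] {e : T → ι → K} (h : IsZariskiAlong e) {ψ : T' → T}
    (hψ : ∀ f : MvPolynomial ι K, IsClosed {t | eval (e (ψ t)) f = 0}) : Continuous ψ := by
  refine continuous_iff_isClosed.2 fun C hC => ?_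
  have : ψ ⁻¹' C = ⋂ f ∈ IsZariskiAlong.idealOf e C, {t | eval (e (ψ t)) f = 0} := by
    ext t
    simp only [Set.mem_preimage, Set.mem_iInter, Set.mem_ofPred_eq]
    refine ⟨fun ht f hf => IsZariskiAlong.mem_idealOf.1 hf _ ht, fun H => ?_⟩
    by_contra ht
    obtain ⟨f, hf, hft⟩ := h.exists_separating C hC _ ht
    exact hft (H f (IsZariskiAlong.mem_idealOf.2 hf))
  rw [this]
  exact isClosed_biInter fun f _ => hψ f

/-- The minor of a pair of vectors in columns `i`, `j`. -/
def minor {N ι : Type} [CommRing N] (i j : ι) (v : ι → N) (w : ι → N) : N :=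
  v i * w j - v j * w i

/-- The pair of vectors spanning the same line, normalized to be the identity in columns
`i`, `j`. -/
def rowReduce {N ι : Type} [Field N] (i j : ι) (v : Fin 2 → ι → N) : Fin 2 → ι → N :=
  ![fun l => (v 1 j * v 0 l - v 0 j * v 1 l) / minor i j (v 0) (v 1),
    fun l => (v 0 i * v 1 l - v 1 i * v 0 l) / minor i j (v 0) (v 1)]

theorem rowReduce_zero_apply {N ι : Type} [Field N] (i j : ι) (v : Fin 2 → ι → N) (l : ι) :
    rowReduce i j v 0 l = (v 1 j * v 0 l - v 0 j * v 1 l) / minor i j (v 0) (v 1) := rfl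

theorem rowReduce_one_apply {N ι : Type} [Field N] (i j : ι) (v : Fin 2 → ι → N) (l : ι) :
    rowReduce i j v 1 l = (v 0 i * v 1 l - v 1 i * v 0 l) / minor i j (v 0) (v 1) := rfl

theorem exists_clear_denominators {K ι : Type} [Field K] (i j : ι)
    (f : MvPolynomial (Fin 2 × ι) K) :
    ∃ (F : MvPolynomial (Fin 2 × ι) K) (m : ℕ), ∀ (N : Type) [Field N] [Algebra K N]
      (v : Fin 2 → ι → N), minor i j (v 0) (v 1) ≠ 0 →
      aeval (fun p => v p.1 p.2) F =
        minor i j (v 0) (v 1) ^ m * aeval (fun p => rowReduce i j v p.1 p.2) f := by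
  let Δ : MvPolynomial (Fin 2 × ι) K := X (0, i) * X (1, j) - X (0, j) * X (1, i)
  have hΔ (N : Type) [Field N] [Algebra K N] (v : Fin 2 → ι → N) :
      aeval (fun p : Fin 2 × ι => v p.1 p.2) Δ = minor i j (v 0) (v 1) := by
    simp [Δ, minor]
  induction f using MvPolynomial.induction_on with
  | C a => exact ⟨C a, 0, fun N _ _ v _ => by simp⟩
  | add f g hf hg =>
    obtain ⟨F, m, hF⟩ := hf
    obtain ⟨G, n, hG⟩ := hg
    refine ⟨F * Δ ^ n + G * Δ ^ m, m + n, fun N _ _ v hv => ?_⟩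
    simp only [map_add, map_mul, map_pow, hΔ, hF N v hv, hG N v hv]
    ring
  | mul_X f p hf =>
    obtain ⟨F, m, hF⟩ := hf
    obtain ⟨a, l⟩ := p
    have hG : ∃ G : MvPolynomial (Fin 2 × ι) K, ∀ (N : Type) [Field N] [Algebra K N]
        (v : Fin 2 → ι → N), minor i j (v 0) (v 1) ≠ 0 →
        aeval (fun p => v p.1 p.2) G = minor i j (v 0) (v 1) * rowReduce i j v a l := by
      match a with
      | 0 =>
        refine ⟨X (1, j) * X (0, l) - X (0, j) * X (1, l), fun N _ _ v hv => ?_⟩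
        rw [rowReduce_zero_apply, mul_div_cancel₀ _ hv]
        simp
      | 1 =>
        refine ⟨X (0, i) * X (1, l) - X (1, i) * X (0, l), fun N _ _ v hv => ?_⟩
        rw [rowReduce_one_apply, mul_div_cancel₀ _ hv]
        simp
    obtain ⟨G, hG⟩ := hG
    refine ⟨F * G, m + 1, fun N _ _ v hv => ?_⟩
    simp only [map_mul, hF N v hv, hG N v hv, aeval_X]
    ring

theorem linearIndependent_fin_two {K V : Type} [Field K] [AddCommGroup V] [Module K V]
    {v : Fin 2 → V} : LinearIndependent K v ↔
      ∀ s t : K, s • v 0 + t • v 1 = 0 → s = 0 ∧ t = 0 := by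
  rw [← LinearIndependent.pair_iff]
  congr!
  ext i; fin_cases i <;> rfl

theorem mem_span_range_fin_two {K V : Type} [Field K] [AddCommGroup V] [Module K V]
    {v : Fin 2 → V} {w : V} : w ∈ Submodule.span K (Set.range v) ↔
      ∃ s t : K, s • v 0 + t • v 1 = w := by
  rw [Submodule.mem_span_range_iff_exists_fun]
  constructor
  · rintro ⟨c, hc⟩
    exact ⟨c 0, c 1, by simpa [Fin.sum_univ_two] using hc⟩
  · rintro ⟨s, t, h⟩
    exact ⟨![s, t], by simpa [Fin.sum_univ_two] using h⟩

theorem mk_mem_projLinear_iff {K : Type} [Field K] {n : ℕ}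
    (W : Submodule K (Fin (n + 1) → K)) (v : Fin (n + 1) → K) (hv : v ≠ 0) :
    Projectivization.mk K v hv ∈ projLinear K W ↔ v ∈ W := by
  obtain ⟨a, ha⟩ := Projectivization.exists_smul_eq_mk_rep K v hv
  change (Projectivization.mk K v hv).rep ∈ W ↔ _
  rw [← ha]
  exact W.smul_mem_iff' a

theorem projLinear_injective {K : Type} [Field K] {n : ℕ} :
    Function.Injective (projLinear K (n := n)) := by
  intro W W' h
  ext v
  by_cases hv : v = 0
  · simp [hv]
  · rw [← mk_mem_projLinear_iff W v hv, h, mk_mem_projLinear_iff]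

theorem lineOf_eq_iff {K : Type} [Field K] {n : ℕ} {u v : Stiefel2 K n} :
    lineOf K u = lineOf K v ↔
      Submodule.span K (Set.range u.1) = Submodule.span K (Set.range v.1) :=
  ⟨fun h => projLinear_injective (congrArg Subtype.val h),
    fun h => Subtype.ext (congrArg (projLinear K) h)⟩

theorem lineOf_surjective {K : Type} [Field K] {n : ℕ} :
    Function.Surjective (lineOf K (n := n)) := by
  rintro ⟨_, W, hW, rfl⟩
  have := Module.finite_of_finrank_pos (R := K) (M := W) (by omega)
  let b := Module.finBasisOfFinrankEq K W hW
  have hb : LinearIndependent K (fun i => (b i : Fin (n + 1) → K)) :=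
    b.linearIndependent.map' W.subtype (Submodule.ker_subtype W)
  refine ⟨⟨_, hb⟩, Subtype.ext (congrArg (projLinear K) ?_)⟩
  have h := congrArg (Submodule.map W.subtype) b.span_eq
  rw [Submodule.map_span, Submodule.map_top, Submodule.range_subtype, ← Set.range_comp] at h
  exact h

theorem exists_minor_ne_zero {K : Type} [Field K] {n : ℕ} (u : Stiefel2 K n) :
    ∃ i j, minor i j (u.1 0) (u.1 1) ≠ 0 := by
  by_contra! h
  have hu := linearIndependent_fin_two.1 u.2
  have hz (i) : u.1 0 i = 0 := by
    have := (hu (u.1 1 i) (-u.1 0 i) (by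
      ext j
      have := h j i
      simp only [minor] at this
      simp only [Pi.add_apply, Pi.smul_apply, smul_eq_mul, Pi.zero_apply]
      linear_combination this)).2
    simpa using this
  exact one_ne_zero (hu 1 0 (by ext i; simp [hz])).1

theorem aeval_apply_eq_eval {K σ : Type} [Field K] (v : σ → K) (f : MvPolynomial σ K) :
    aeval v f = eval v f := rfl

/-- Pairs of vectors that are the identity in columns `i`, `j`. -/
def NormalPair (K : Type) [Field K] {n : ℕ} (i j : Fin (n + 1)) : Type :=
  {a : Stiefel2 K n // a.1 0 i = 1 ∧ a.1 0 j = 0 ∧ a.1 1 i = 0 ∧ a.1 1 j = 1}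

instance {K : Type} [Field K] {n : ℕ} (i j : Fin (n + 1)) :
    TopologicalSpace (NormalPair K i j) :=
  inferInstanceAs (TopologicalSpace {a : Stiefel2 K n //
    a.1 0 i = 1 ∧ a.1 0 j = 0 ∧ a.1 1 i = 0 ∧ a.1 1 j = 1})

namespace NormalPair

variable {K : Type} [Field K] {n : ℕ} {i j : Fin (n + 1)}

theorem lineOf_eq_lineOf_iff (u : Stiefel2 K n) (a : NormalPair K i j) :
    lineOf K u = lineOf K a.1 ↔
      minor i j (u.1 0) (u.1 1) ≠ 0 ∧ rowReduce i j u.1 = a.1.1 := by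
  obtain ⟨a, h0i, h0j, h1i, h1j⟩ := a
  have hu := linearIndependent_fin_two.1 u.2
  rw [lineOf_eq_iff]
  constructor
  · intro h
    have hmem (s : Fin 2) (l) : u.1 s l = u.1 s i * a.1 0 l + u.1 s j * a.1 1 l := by
      have hs : u.1 s ∈ Submodule.span K (Set.range a.1) := h ▸ Submodule.subset_span ⟨s, rfl⟩
      obtain ⟨c, d, hcd⟩ := mem_span_range_fin_two.1 hs
      simp [← hcd, h0i, h0j, h1i, h1j]
    have hm : minor i j (u.1 0) (u.1 1) ≠ 0 := by
      intro hm
      have e1 := hu (u.1 1 j) (-u.1 0 j) (by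
        ext l
        simp only [minor] at hm
        simp only [Pi.add_apply, Pi.smul_apply, smul_eq_mul, Pi.zero_apply]
        rw [hmem 0 l, hmem 1 l]
        linear_combination a.1 0 l * hm)
      have e2 := hu (u.1 1 i) (-u.1 0 i) (by
        ext l
        simp only [minor] at hm
        simp only [Pi.add_apply, Pi.smul_apply, smul_eq_mul, Pi.zero_apply]
        rw [hmem 0 l, hmem 1 l]
        linear_combination -a.1 1 l * hm)
      refine one_ne_zero (hu 1 0 ?_).1
      ext l
      simp only [Pi.add_apply, Pi.smul_apply, smul_eq_mul, Pi.zero_apply]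
      rw [hmem 0 l, neg_eq_zero.1 e1.2, neg_eq_zero.1 e2.2]
      ring
    refine ⟨hm, ?_⟩
    ext s l
    match s with
    | 0 =>
      rw [rowReduce_zero_apply, div_eq_iff hm, hmem 0 l, hmem 1 l, minor]
      ring
    | 1 =>
      rw [rowReduce_one_apply, div_eq_iff hm, hmem 0 l, hmem 1 l, minor]
      ring
  · rintro ⟨hm, h⟩
    symm
    refine Submodule.eq_of_le_of_finrank_eq (Submodule.span_le.2 ?_) ?_
    · rintro _ ⟨s, rfl⟩
      rw [← h]
      refine mem_span_range_fin_two.2 ?_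
      match s with
      | 0 =>
        refine ⟨u.1 1 j / minor i j (u.1 0) (u.1 1), -u.1 0 j / minor i j (u.1 0) (u.1 1), ?_⟩
        ext l
        simp only [Pi.add_apply, Pi.smul_apply, smul_eq_mul]
        rw [rowReduce_zero_apply]
        ring
      | 1 =>
        refine ⟨-u.1 1 i / minor i j (u.1 0) (u.1 1), u.1 0 i / minor i j (u.1 0) (u.1 1), ?_⟩
        ext l
        simp only [Pi.add_apply, Pi.smul_apply, smul_eq_mul]
        rw [rowReduce_one_apply]
        ring
    · rw [finrank_span_eq_card a.2, finrank_span_eq_card u.2]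

theorem exists_eq_rowReduce (u : Stiefel2 K n) (hu : minor i j (u.1 0) (u.1 1) ≠ 0) :
    ∃ a : NormalPair K i j, a.1.1 = rowReduce i j u.1 := by
  have h0i : rowReduce i j u.1 0 i = 1 := by
    rw [rowReduce_zero_apply, div_eq_one_iff_eq hu, minor]
    ring
  have h0j : rowReduce i j u.1 0 j = 0 := by
    rw [rowReduce_zero_apply, mul_comm, sub_self, zero_div]
  have h1i : rowReduce i j u.1 1 i = 0 := by
    rw [rowReduce_one_apply, mul_comm, sub_self, zero_div]
  have h1j : rowReduce i j u.1 1 j = 1 := by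
    rw [rowReduce_one_apply, div_eq_one_iff_eq hu, minor]
    ring
  refine ⟨⟨⟨rowReduce i j u.1, linearIndependent_fin_two.2 fun s t h => ?_⟩,
    h0i, h0j, h1i, h1j⟩, rfl⟩
  have hi := congrFun h i
  have hj := congrFun h j
  simp only [Pi.add_apply, Pi.smul_apply, smul_eq_mul, Pi.zero_apply, h0i, h0j, h1i, h1j] at hi hj
  simpa using And.intro hi hj

theorem isZariskiAlong (K : Type) [Field K] {n : ℕ} (i j : Fin (n + 1)) :
    IsZariskiAlong (fun (a : NormalPair K i j) (p : Fin 2 × Fin (n + 1)) => a.1.1 p.1 p.2) :=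
  (isZariskiAlong_stiefel2 K n).comp_isInducing Topology.IsInducing.subtypeVal

theorem continuous_lineOf : Continuous (lineOf K (n := n)) := continuous_coinduced_rng

theorem isOpenEmbedding_lineOf :
    Topology.IsOpenEmbedding (fun a : NormalPair K i j => lineOf K a.1) := by
  refine .of_continuous_injective_isOpenMap (continuous_lineOf.comp continuous_subtype_val) ?_ ?_
  · intro a b h
    have h1 := ((lineOf_eq_lineOf_iff a.1 b).1 h).2
    have h2 := ((lineOf_eq_lineOf_iff a.1 a).1 rfl).2
    exact Subtype.ext (Subtype.ext (h2.symm.trans h1))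
  · intro O hO
    let D : Set (Stiefel2 K n) := {u | minor i j (u.1 0) (u.1 1) ≠ 0}
    have hD : IsOpen D := by
      rw [← isClosed_compl_iff]
      convert (isZariskiAlong_stiefel2 K n).isClosed_zero
        (X (0, i) * X (1, j) - X (0, j) * X (1, i)) using 1
      ext u
      simp [D, minor]
    choose ρ hρ using fun u : D => exists_eq_rowReduce u.1 u.2
    have hρc : Continuous ρ := by
      refine (isZariskiAlong K i j).continuous_of fun f => ?_
      obtain ⟨F, m, hF⟩ := exists_clear_denominators i j f
      convert ((isZariskiAlong_stiefel2 K n).isClosed_zero F).preimage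
        (continuous_subtype_val (p := (· ∈ D))) using 1
      ext u
      have := hF K u.1.1 u.2
      rw [aeval_apply_eq_eval, aeval_apply_eq_eval] at this
      change eval _ f = 0 ↔ eval _ F = 0
      rw [this, hρ]
      simp [show minor i j (u.1.1 0) (u.1.1 1) ≠ 0 from u.2]
    change IsOpen (lineOf K ⁻¹' _)
    convert hD.isOpenMap_subtype_val _ (hO.preimage hρc) using 1
    ext u
    constructor
    · rintro ⟨a, ha, hau⟩
      obtain ⟨hm, hr⟩ := (lineOf_eq_lineOf_iff u a).1 hau.symm
      have hra : ρ ⟨u, hm⟩ = a := Subtype.ext (Subtype.ext ((hρ ⟨u, hm⟩).trans hr))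
      exact ⟨⟨u, hm⟩, by rwa [Set.mem_preimage, hra], rfl⟩
    · rintro ⟨u, hu, rfl⟩
      exact ⟨ρ u, hu, ((lineOf_eq_lineOf_iff u.1 (ρ u)).2 ⟨u.2, (hρ u).symm⟩).symm⟩

end NormalPair

/-- A generic pair of vectors for a family `𝒰` moves, after row reduction, with at least as many
parameters as the family of lines it spans. -/
theorem exists_le_finrank_evalTuple_rowReduce {K N : Type} [Field K] [CharZero K] [Field N]
    [Algebra K N] {n : ℕ}
    (𝒰 : Set (Stiefel2 K n)) (x : Fin 2 → Fin (n + 1) → N)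
    (hx : ∀ f : MvPolynomial (Fin 2 × Fin (n + 1)) K, aeval (fun p => x p.1 p.2) f = 0 ↔
      ∀ u ∈ 𝒰, eval (fun p => u.1 p.1 p.2) f = 0) (d : ℕ)
    (hd : (d : WithBot ℕ∞) ≤ sdim (closure (lineOf K '' 𝒰))) :
    ∃ i j, minor i j (x 0) (x 1) ≠ 0 ∧ d ≤ Module.finrank N
      (LinearMap.range (Derivation.evalTuple K fun p : Fin 2 × Fin (n + 1) =>
        rowReduce i j x p.1 p.2)) := by
  set S := closure (lineOf K '' 𝒰)
  let σ (ij : Fin (n + 1) × Fin (n + 1)) (a : NormalPair K ij.1 ij.2) : Grass K n := lineOf K a.1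
  have hσ (ij) : Topology.IsOpenEmbedding (σ ij) := NormalPair.isOpenEmbedding_lineOf
  obtain ⟨⟨i, j⟩, hij⟩ := exists_le_topologicalKrullDim_of_isOpenEmbedding
    (fun ij => S.restrictPreimage (σ ij)) (fun ij => (hσ ij).restrictPreimage S) (by
      rintro ⟨l, hl⟩
      obtain ⟨u, rfl⟩ := lineOf_surjective l
      obtain ⟨i, j, hu⟩ := exists_minor_ne_zero u
      obtain ⟨a, ha⟩ := NormalPair.exists_eq_rowReduce u hu
      have hua := (NormalPair.lineOf_eq_lineOf_iff u a).2 ⟨hu, ha.symm⟩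
      exact ⟨(i, j), ⟨a, by change lineOf K a.1 ∈ S; rwa [← hua]⟩, Subtype.ext hua.symm⟩) d hd
  let C := σ (i, j) ⁻¹' S
  have hC : C = closure (σ (i, j) ⁻¹' (lineOf K '' 𝒰)) :=
    (hσ (i, j)).isOpenMap.preimage_closure_eq_closure_preimage (hσ (i, j)).continuous _
  have hmem {a : NormalPair K i j} (ha : a ∈ σ (i, j) ⁻¹' (lineOf K '' 𝒰)) :
      ∃ u ∈ 𝒰, minor i j (u.1 0) (u.1 1) ≠ 0 ∧ rowReduce i j u.1 = a.1.1 := by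
    obtain ⟨u, hu, hua⟩ := ha
    exact ⟨u, hu, (NormalPair.lineOf_eq_lineOf_iff u a).1 hua⟩
  have hCne : C.Nonempty := by
    rw [← Set.nonempty_coe_sort]
    refine not_isEmpty_iff.1 fun hE => ?_
    have : topologicalKrullDim C = ⊥ := Order.krullDim_eq_bot_iff.2 ⟨fun c => hE.elim c.isIrreducible'.nonempty.some⟩
    exact absurd (hij.trans_eq this) (by simp)
  have hm : minor i j (x 0) (x 1) ≠ 0 := by
    rw [hC, closure_nonempty_iff] at hCne
    obtain ⟨a, ha⟩ := hCne
    obtain ⟨u, hu, hum, -⟩ := hmem ha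
    intro hm
    refine hum ?_
    have := (hx (X (0, i) * X (1, j) - X (0, j) * X (1, i))).1 (by simpa [minor] using hm) u hu
    simpa [minor] using this
  refine ⟨i, j, hm, ?_⟩
  have hZ : IsZariskiAlong (fun (a : C) (p : Fin 2 × Fin (n + 1)) => a.1.1.1 p.1 p.2) :=
    (NormalPair.isZariskiAlong K i j).comp_isInducing Topology.IsInducing.subtypeVal
  have h := hij.trans (hZ.topologicalKrullDim_le
    (RingHom.ker (aeval (R := K) fun p : Fin 2 × Fin (n + 1) => rowReduce i j x p.1 p.2)) ?_)
  · rw [ringKrullDim_quotient_ker_aeval] at h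
    exact_mod_cast h
  · intro f hf ⟨a, ha⟩
    rw [RingHom.mem_ker] at hf
    obtain ⟨F, m, hF⟩ := exists_clear_denominators i j f
    have hFx : aeval (fun p : Fin 2 × Fin (n + 1) => x p.1 p.2) F = 0 := by
      rw [hF N x hm]
      exact mul_eq_zero_of_right _ hf
    change eval (fun p : Fin 2 × Fin (n + 1) => a.1.1 p.1 p.2) f = 0
    rw [hC] at ha
    refine closure_minimal (fun b hb => ?_) ((NormalPair.isZariskiAlong K i j).isClosed_zero f) ha
    obtain ⟨u, hu, hum, hub⟩ := hmem hb
    have h1 := hF K u.1 hum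
    rw [aeval_apply_eq_eval, aeval_apply_eq_eval, (hx F).1 hFx u hu, hub] at h1
    exact (mul_eq_zero.1 h1.symm).resolve_left (pow_ne_zero m hum)

theorem Derivation.finrank_evalTuple_add_le {K N ι : Type} [Field K] [Field N] [Algebra K N]
    [Finite ι] {P Q : ι → N} {c : N} (hc : c ≠ 0) {a b : ℕ}
    (hP : Module.finrank N (LinearMap.range (Derivation.evalTuple K P)) ≤ a)
    (hQ : Module.finrank N (LinearMap.range (Derivation.evalTuple K Q)) ≤ b)
    (hV : Module.finrank N (LinearMap.range (Derivation.evalTuple K (P + c • Q))) ≤ b)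
    (hPQ : a + b ≤ Module.finrank N (LinearMap.range
      ((Derivation.evalTuple K P).prod (Derivation.evalTuple K Q)))) :
    Module.finrank N (LinearMap.range (Derivation.evalTuple K (P + Q))) ≤ b + 1 := by
  have := Fintype.ofFinite ι
  set gP := Derivation.evalTuple K P with hgP
  set gQ := Derivation.evalTuple K Q with hgQ
  set gV := Derivation.evalTuple K (P + c • Q) with hgV
  have h1 := LinearMap.finrank_range_eq_add_of_ker_le (gP.prod gQ) gQ (by
    rw [LinearMap.ker_prod]; exact inf_le_right)
  have h2 : Submodule.map (gP.prod gQ) (LinearMap.ker gQ) ≤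
      Submodule.map (LinearMap.inl N (ι → N) (ι → N)) (Submodule.map gP (LinearMap.ker gQ)) := by
    rintro _ ⟨D, hD, rfl⟩
    exact ⟨gP D, ⟨D, hD, rfl⟩, by simpa using (LinearMap.mem_ker.1 hD).symm⟩
  have h3 := (Submodule.finrank_mono h2).trans (Submodule.finrank_map_le _ _)
  have h4 : Submodule.map gP (LinearMap.ker gQ) = LinearMap.range gP :=
    Submodule.eq_of_le_of_finrank_le (LinearMap.map_le_range) (by omega)
  have hTP : LinearMap.range gP ≤ LinearMap.range gV ⊔ Submodule.span N {Q} := by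
    rw [← h4]
    rintro _ ⟨D, hD, rfl⟩
    refine Submodule.mem_sup.2 ⟨gV D, ⟨D, rfl⟩, (-D c) • Q,
      Submodule.smul_mem _ _ (Submodule.mem_span_singleton_self Q), ?_⟩
    ext i
    have hDi : D (Q i) = 0 := congrFun (LinearMap.mem_ker.1 hD) i
    simp [hgV, hgP, hDi]
    ring
  have hTX : LinearMap.range (Derivation.evalTuple K (P + Q)) ≤
      LinearMap.range gV ⊔ Submodule.span N {Q} := by
    rintro _ ⟨D, rfl⟩
    have hQD : gQ D = c⁻¹ • (gV D - gP D - D c • Q) := by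
      ext i
      simp [hgV, hgP, hgQ]
      field_simp
      ring
    have hXD : Derivation.evalTuple K (P + Q) D = gP D + gQ D := by
      ext i
      simp [hgP, hgQ]
    rw [hXD, hQD]
    have hp := hTP ⟨D, rfl⟩
    refine add_mem hp (Submodule.smul_mem _ _ (sub_mem (sub_mem ?_ hp) ?_))
    · exact Submodule.mem_sup_left ⟨D, rfl⟩
    · exact Submodule.mem_sup_right
        (Submodule.smul_mem _ _ (Submodule.mem_span_singleton_self Q))
  have h5 := Submodule.finrank_mono hTX
  have h6 := Submodule.finrank_add_le_finrank_add_finrank (LinearMap.range gV)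
    (Submodule.span N {Q})
  have h7 : Module.finrank N (Submodule.span N {Q}) ≤ 1 := by
    simpa using finrank_span_le_card (R := N) {Q}
  omega

theorem Derivation.finrank_rowReduce_add_two_le {K N ι : Type} [Field K] [Field N] [Algebra K N]
    [Finite ι] {x : Fin 2 → ι → N} (h0 : x 0 ≠ 0) (h1 : x 1 ≠ 0) {i j : ι}
    (hm : minor i j (x 0) (x 1) ≠ 0) {s t : N} (hs : s ≠ 0) (ht : t ≠ 0)
    {E₁ E₂ : Derivation K N N} (hE₁ : ∀ a l, E₁ (x a l) = 0) (hE₂ : ∀ a l, E₂ (x a l) = 0)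
    (h11 : E₁ s = s) (h12 : E₁ t = 0) (h21 : E₂ s = 0) (h22 : E₂ t = t) :
    Module.finrank N (LinearMap.range (Derivation.evalTuple K fun p : Fin 2 × ι =>
        rowReduce i j x p.1 p.2)) + 2 ≤
      Module.finrank N (LinearMap.range
        ((Derivation.evalTuple K (s • x 0)).prod (Derivation.evalTuple K (t • x 1)))) := by
  have := Fintype.ofFinite ι
  have hker (D : Derivation K N N) (y : Fin 2 → ι → N) (hD : ∀ a l, D (y a l) = 0) (a : Fin 2)
      (l : ι) : D (rowReduce i j y a l) = 0 := by
    match a with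
    | 0 => simp [rowReduce_zero_apply, minor, Derivation.leibniz_div, hD]
    | 1 => simp [rowReduce_one_apply, minor, Derivation.leibniz_div, hD]
  have hscale : rowReduce i j ![s • x 0, t • x 1] = rowReduce i j x := by
    have hm' : minor i j (s • x 0) (t • x 1) = s * t * minor i j (x 0) (x 1) := by
      simp only [minor, Pi.smul_apply, smul_eq_mul]
      ring
    ext a l
    match a with
    | 0 =>
      simp only [rowReduce_zero_apply, Matrix.cons_val_zero, Matrix.cons_val_one, hm',
        Pi.smul_apply, smul_eq_mul]
      field_simp
    | 1 =>
      simp only [rowReduce_one_apply, Matrix.cons_val_zero, Matrix.cons_val_one, hm',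
        Pi.smul_apply, smul_eq_mul]
      field_simp
  set f := (Derivation.evalTuple K (s • x 0)).prod (Derivation.evalTuple K (t • x 1)) with hf
  set g := Derivation.evalTuple K fun p : Fin 2 × ι => rowReduce i j x p.1 p.2 with hg
  have hE₁g : E₁ ∈ LinearMap.ker g := funext fun p => hker E₁ x hE₁ p.1 p.2
  have hE₂g : E₂ ∈ LinearMap.ker g := funext fun p => hker E₂ x hE₂ p.1 p.2
  have hfE₁ : f E₁ = (s • x 0, 0) := by
    ext l <;> simp [hf, hE₁, h11, h12, mul_comm]
  have hfE₂ : f E₂ = (0, t • x 1) := by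
    ext l <;> simp [hf, hE₂, h21, h22, mul_comm]
  rw [LinearMap.finrank_range_eq_add_of_ker_le f g]
  · gcongr
    have hli : LinearIndependent N ![f E₁, f E₂] := by
      rw [LinearIndependent.pair_iff, hfE₁, hfE₂]
      intro a b hab
      simpa [Prod.ext_iff, hs, ht, h0, h1] using hab
    refine (finrank_span_eq_card hli).symm.le.trans
      (Submodule.finrank_mono (Submodule.span_le.2 ?_))
    rintro _ ⟨a, rfl⟩
    match a with
    | 0 => exact ⟨E₁, hE₁g, rfl⟩
    | 1 => exact ⟨E₂, hE₂g, rfl⟩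
  · intro D hD
    have hD' := Prod.ext_iff.1 (LinearMap.mem_ker.1 hD)
    refine funext fun p => ?_
    change D (rowReduce i j x p.1 p.2) = 0
    rw [← hscale]
    refine hker D _ (fun a l => ?_) p.1 p.2
    match a with
    | 0 => exact congrFun hD'.1 l
    | 1 => exact congrFun hD'.2 l

/-- `y` is a generic point of the family `𝒰` of pairs of vectors. -/
def IsGenericPair {K N : Type} [Field K] [Field N] [Algebra K N] {r : ℕ} (𝒰 : Set (Stiefel2 K r))
    (y : Fin 2 → Fin (r + 1) → N) : Prop :=
  ∀ f : MvPolynomial (Fin 2 × Fin (r + 1)) K, aeval (fun p => y p.1 p.2) f = 0 ↔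
    ∀ u ∈ 𝒰, eval (fun p => u.1 p.1 p.2) f = 0

namespace IsGenericPair

variable {K N : Type} [Field K] [Field N] [Algebra K N] {r : ℕ} {𝒰 : Set (Stiefel2 K r)}
  {y : Fin 2 → Fin (r + 1) → N}

theorem aeval_add_eq_zero_iff (hy : IsGenericPair 𝒰 y) (s t : K)
    (F : MvPolynomial (Fin (r + 1)) K) :
    aeval (s • y 0 + t • y 1) F = 0 ↔ ∀ u ∈ 𝒰, eval (s • u.1 0 + t • u.1 1) F = 0 := by
  have key {M : Type} [Field M] [Algebra K M] (z : Fin 2 → Fin (r + 1) → M) :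
      aeval (fun p : Fin 2 × Fin (r + 1) => z p.1 p.2)
        (bind₁ (fun l => C s * X (0, l) + C t * X (1, l)) F) = aeval (s • z 0 + t • z 1) F := by
    rw [aeval_bind₁]
    congr 2
    ext l
    simp [Algebra.smul_def]
  rw [← key y, hy]
  refine forall₂_congr fun u _ => ?_
  rw [← aeval_apply_eq_eval, ← aeval_apply_eq_eval, key u.1]

theorem add_ne_zero (hy : IsGenericPair 𝒰 y) (h𝒰 : 𝒰.Nonempty) {s t : K} (hst : s ≠ 0 ∨ t ≠ 0) :
    s • y 0 + t • y 1 ≠ 0 := by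
  intro h
  obtain ⟨u, hu⟩ := h𝒰
  have h0 : s • u.1 0 + t • u.1 1 = 0 := by
    ext l
    have := (hy.aeval_add_eq_zero_iff s t (X l)).1 (by rw [aeval_X, h, Pi.zero_apply]) u hu
    rwa [eval_X] at this
  have := linearIndependent_fin_two.1 u.2 s t h0
  tauto

theorem finrank_evalTuple_le [IsAlgClosed K] [CharZero K] (hy : IsGenericPair 𝒰 y)
    (h𝒰 : 𝒰.Nonempty) {m : ℕ} {W : Set (Pn K r)} (hW : IsClosed W)
    (hdim : sdim W ≤ (m : WithBot ℕ∞)) {s t : K} (hst : s ≠ 0 ∨ t ≠ 0)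
    (hmem : ∀ u ∈ 𝒰, ∃ h : s • u.1 0 + t • u.1 1 ≠ 0, Projectivization.mk K _ h ∈ W)
    {a : N} (ha : a ≠ 0) {ζ : Fin (r + 1) → N} (hζ : ζ = a • (s • y 0 + t • y 1)) :
    Module.finrank N (LinearMap.range (Derivation.evalTuple K ζ)) ≤ m + 1 := by
  subst hζ
  refine finrank_evalTuple_le_of_sdim_le hW hdim _ (smul_ne_zero ha (hy.add_ne_zero h𝒰 hst))
    fun F d hF hFW => ?_
  refine (aeval_mul_of_isHomogeneous hF a _).trans (mul_eq_zero_of_right _ ?_)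
  refine (hy.aeval_add_eq_zero_iff s t F).2 fun u hu => ?_
  obtain ⟨h, huW⟩ := hmem u hu
  exact (eval_rep_mk_eq_zero_iff hF _ h).1 (hFW _ huW)

theorem exists_form [IsAlgClosed K] [CharZero K] {L : Type} [Field L] [Algebra K L] [Algebra L N]
    [IsScalarTower K L N] {x : Fin 2 → Fin (r + 1) → L} (hx : IsGenericPair 𝒰 x)
    {b : Fin 2 → N} (hb : AlgebraicIndependent L b) (h𝒰 : 𝒰.Nonempty)
    {n k : ℕ} (hr : n + 1 < r) {Y Z : Set (Pn K r)} (hZ : IsClosed Z)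
    (hZdim : sdim Z ≤ (n : WithBot ℕ∞)) (hY : IsClosed Y) (hYdim : sdim Y ≤ (k : WithBot ℕ∞))
    (hp : ∀ u ∈ 𝒰, ∃ h : u.1 0 ≠ 0, Projectivization.mk K _ h ∈ Y)
    (hq : ∀ u ∈ 𝒰, ∃ h : u.1 1 ≠ 0, Projectivization.mk K _ h ∈ Z)
    (hpq : ∀ u ∈ 𝒰, ∃ h : u.1 0 + u.1 1 ≠ 0, Projectivization.mk K _ h ∈ Z)
    (hS : ((n + k : ℕ) : WithBot ℕ∞) ≤ sdim (closure (lineOf K '' 𝒰))) :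
    ∃ F : MvPolynomial (Fin (r + 1)) K, F ≠ 0 ∧
      ∀ s t : K, ∀ u ∈ 𝒰, eval (s • u.1 0 + t • u.1 1) F = 0 := by
  have : CharZero L := charZero_of_injective_algebraMap (algebraMap K L).injective
  let y : Fin 2 → Fin (r + 1) → N := fun a l => algebraMap L N (x a l)
  have hy : IsGenericPair 𝒰 y := fun f => by
    rw [← hx f, ← map_eq_zero (algebraMap L N), ← aeval_algebraMap_apply]
    rfl
  have hb0 := hb.ne_zero 0
  have hb1 := hb.ne_zero 1
  have hy0 : y 0 ≠ 0 := by simpa using hy.add_ne_zero h𝒰 (s := 1) (t := 0) (by simp)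
  have hy1 : y 1 ≠ 0 := by simpa using hy.add_ne_zero h𝒰 (s := 0) (t := 1) (by simp)
  have hTP : Module.finrank N (LinearMap.range (Derivation.evalTuple K (b 0 • y 0))) ≤ k + 1 :=
    hy.finrank_evalTuple_le h𝒰 hY hYdim (s := 1) (t := 0) (by simp)
      (by simpa using hp) hb0 (by simp)
  have hTQ : Module.finrank N (LinearMap.range (Derivation.evalTuple K (b 1 • y 1))) ≤ n + 1 :=
    hy.finrank_evalTuple_le h𝒰 hZ hZdim (s := 0) (t := 1) (by simp)
      (by simpa using hq) hb1 (by simp)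
  have hTV : Module.finrank N
      (LinearMap.range (Derivation.evalTuple K (b 0 • (y 0 + y 1)))) ≤ n + 1 :=
    hy.finrank_evalTuple_le h𝒰 hZ hZdim (s := 1) (t := 1) (by simp)
      (by simpa using hpq) hb0 (by simp)
  obtain ⟨i, j, hm, hg⟩ := exists_le_finrank_evalTuple_rowReduce 𝒰 y hy (n + k) hS
  obtain ⟨E₁, hE₁⟩ := hb.exists_derivation ![b 0, 0]
  obtain ⟨E₂, hE₂⟩ := hb.exists_derivation ![0, b 1]
  have hPQ := Derivation.finrank_rowReduce_add_two_le hy0 hy1 hm hb0 hb1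
    (E₁ := E₁.restrictScalars K) (E₂ := E₂.restrictScalars K)
    (fun a l => E₁.map_algebraMap _) (fun a l => E₂.map_algebraMap _)
    (hE₁ 0) (hE₁ 1) (hE₂ 0) (hE₂ 1)
  have hX := Derivation.finrank_evalTuple_add_le (K := K) (P := b 0 • y 0) (Q := b 1 • y 1)
    (c := b 0 / b 1) (div_ne_zero hb0 hb1) hTP hTQ (by
      rwa [smul_smul, div_mul_cancel₀ _ hb1, ← smul_add]) (by omega)
  have hXdep : ¬ AlgebraicIndependent K (b 0 • y 0 + b 1 • y 1) := by
    intro h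
    rw [h.range_evalTuple, finrank_top, Module.finrank_fin_fun] at hX
    omega
  rw [algebraicIndependent_iff] at hXdep
  push Not at hXdep
  obtain ⟨F, hF, hF0⟩ := hXdep
  refine ⟨F, hF0, fun s t => (hx.aeval_add_eq_zero_iff s t F).1 ?_⟩
  let G : MvPolynomial (Fin 2) L :=
    aeval (fun l => C (x 0 l) * X 0 + C (x 1 l) * X 1 : Fin (r + 1) → MvPolynomial (Fin 2) L) F
  have hGapply {M : Type} [Field M] [Algebra K M] [Algebra L M] [IsScalarTower K L M]
      (c : Fin 2 → M) : aeval c G =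
        aeval (fun l => algebraMap L M (x 0 l) * c 0 + algebraMap L M (x 1 l) * c 1) F := by
    refine (comp_aeval_apply (R := K) _ ((aeval (R := L) c).restrictScalars K) F).trans ?_
    simp
  have hG : G = 0 := by
    refine (algebraicIndependent_iff.1 hb) G ((hGapply b).trans ?_)
    rw [← hF]
    congr 2
    ext l
    simp [y, mul_comm]
  have := hGapply ![algebraMap K L s, algebraMap K L t]
  rw [hG, map_zero] at this
  rw [this]
  congr 2
  ext l
  simp [Algebra.smul_def, mul_comm]

end IsGenericPair

theorem exists_isGenericPair {K : Type} [Field K] {r : ℕ} {𝒰 : Set (Stiefel2 K r)}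
    (h𝒰 : IsIrreducible 𝒰) : ∃ (L : Type) (_ : Field L) (_ : Algebra K L)
      (x : Fin 2 → Fin (r + 1) → L), IsGenericPair 𝒰 x := by
  let I := IsZariskiAlong.idealOf
    (fun (v : Stiefel2 K r) (p : Fin 2 × Fin (r + 1)) => v.1 p.1 p.2) 𝒰
  have : I.IsPrime := (isZariskiAlong_stiefel2 K r).isPrime_idealOf h𝒰
  let A := MvPolynomial (Fin 2 × Fin (r + 1)) K ⧸ I
  refine ⟨FractionRing A, inferInstance, inferInstance,
    fun a l => algebraMap A (FractionRing A) (Ideal.Quotient.mk I (X (a, l))), fun f => ?_⟩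
  have h : aeval (fun p : Fin 2 × Fin (r + 1) => algebraMap A (FractionRing A)
      (Ideal.Quotient.mk I (X (p.1, p.2)))) f =
      algebraMap A (FractionRing A) (Ideal.Quotient.mk I f) := by
    have := comp_aeval_apply (X : Fin 2 × Fin (r + 1) → MvPolynomial _ K)
      (((IsScalarTower.toAlgHom K A (FractionRing A))).comp (Ideal.Quotient.mkₐ K I)) f
    rw [aeval_X_left_apply] at this
    exact this.symm
  rw [h, map_eq_zero_iff _ (IsFractionRing.injective A (FractionRing A)),
    Ideal.Quotient.eq_zero_iff_mem]
  exact IsZariskiAlong.mem_idealOf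

theorem mk_mem_lineOf_iff {K : Type} [Field K] {n : ℕ} (u : Stiefel2 K n) {w : Fin (n + 1) → K}
    (hw : w ≠ 0) : Projectivization.mk K w hw ∈ (lineOf K u).1 ↔
      ∃ s t : K, s • u.1 0 + t • u.1 1 = w :=
  (mk_mem_projLinear_iff _ w hw).trans mem_span_range_fin_two

theorem linesUnion_ne_univ_of_form {K : Type} [Field K] [Infinite K] {r : ℕ}
    {𝒰 : Set (Stiefel2 K r)} (h𝒰 : 𝒰.Nonempty) {F : MvPolynomial (Fin (r + 1)) K} (hF0 : F ≠ 0)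
    (hF : ∀ s t : K, ∀ u ∈ 𝒰, eval (s • u.1 0 + t • u.1 1) F = 0) :
    linesUnion K (closure (lineOf K '' 𝒰)) ≠ Set.univ := by
  let V : Set (Grass K r) :=
    {l | ∀ w, ∀ hw : w ≠ 0, Projectivization.mk K w hw ∈ l.1 → eval w F = 0}
  have hpre : lineOf K ⁻¹' V = ⋂ (c : K × K) (_ : c ≠ 0),
      {u | eval (c.1 • u.1 0 + c.2 • u.1 1) F = 0} := by
    ext u
    simp only [Set.mem_iInter, Set.mem_ofPred_eq, Set.mem_preimage, V, Prod.forall,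
      mk_mem_lineOf_iff]
    constructor
    · intro h s t hst
      refine h _ (fun h0 => hst ?_) ⟨s, t, rfl⟩
      exact Prod.ext_iff.2 (linearIndependent_fin_two.1 u.2 s t h0)
    · rintro h _ hw ⟨s, t, rfl⟩
      refine h s t fun hst => hw ?_
      obtain ⟨rfl, rfl⟩ := Prod.mk_eq_zero.1 hst
      rw [zero_smul, zero_smul, add_zero]
  have hV : IsClosed V := by
    refine isClosed_coinduced.2 ?_
    rw [hpre]
    refine isClosed_biInter fun c _ => ?_
    convert (isZariskiAlong_stiefel2 K r).isClosed_zero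
      (bind₁ (fun l => C c.1 * X (0, l) + C c.2 * X (1, l)) F) using 1
    ext u
    rw [Set.mem_ofPred_eq, Set.mem_ofPred_eq, ← aeval_apply_eq_eval, ← aeval_apply_eq_eval,
      aeval_bind₁]
    simp
    rfl
  have hSV : closure (lineOf K '' 𝒰) ⊆ V := by
    refine closure_minimal ?_ hV
    rw [Set.image_subset_iff, hpre]
    exact fun u hu => Set.mem_iInter₂.2 fun c _ => hF c.1 c.2 u hu
  intro hcover
  refine hF0 (MvPolynomial.funext fun w => ?_)
  rw [map_zero]
  by_cases hw : w = 0
  · obtain ⟨u, hu⟩ := h𝒰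
    simpa [hw] using hF 0 0 u hu
  · have hmem : Projectivization.mk K w hw ∈ linesUnion K (closure (lineOf K '' 𝒰)) :=
      hcover ▸ Set.mem_univ _
    obtain ⟨l, hl, hwl⟩ := Set.mem_iUnion₂.1 hmem
    exact hSV hl w hw hwl

/-- The pairs of representatives of a point of `Y` and a point of `Z \ Y` whose sum also
represents a point of `Z \ Y`. -/
def trisecantPairs {K : Type} [Field K] {r : ℕ} (Y Z : Set (Pn K r)) : Set (Stiefel2 K r) :=
  {u | (∃ h : u.1 0 ≠ 0, Projectivization.mk K _ h ∈ Y) ∧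
    (∃ h : u.1 1 ≠ 0, Projectivization.mk K _ h ∈ Z \ Y) ∧
    ∃ h : u.1 0 + u.1 1 ≠ 0, Projectivization.mk K _ h ∈ Z \ Y}

theorem trisecantsRel_eq_closure {K : Type} [Field K] {r : ℕ} (Y Z : Set (Pn K r)) :
    trisecantsRel K Y Z = closure (lineOf K '' trisecantPairs Y Z) := by
  refine congrArg closure (Set.ext fun l => ⟨?_, ?_⟩)
  · rintro ⟨p, hp, q₁, hq₁, q₂, hq₂, hq, hpl, hq₁l, hq₂l⟩
    obtain ⟨u, rfl⟩ := lineOf_surjective l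
    induction p using Projectivization.ind with | h v hv =>
    induction q₁ using Projectivization.ind with | h w₁ hw₁ =>
    induction q₂ using Projectivization.ind with | h w₂ hw₂ =>
    have hpq₁ : Projectivization.mk K v hv ≠ Projectivization.mk K w₁ hw₁ :=
      fun h => hq₁.2 (h ▸ hp)
    have hpq₂ : Projectivization.mk K v hv ≠ Projectivization.mk K w₂ hw₂ :=
      fun h => hq₂.2 (h ▸ hp)
    rw [Ne, Projectivization.mk_eq_mk_iff'] at hpq₁ hpq₂ hq
    have hli : LinearIndependent K ![v, w₁] :=
      (LinearIndependent.pair_iff' hv).2 fun a ha => hpq₁ ⟨a⁻¹, by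
        have : a ≠ 0 := fun h => hw₁ (by rw [← ha, h, zero_smul])
        rw [← ha, inv_smul_smul₀ this]⟩
    have hspan : Submodule.span K (Set.range ![v, w₁]) = Submodule.span K (Set.range u.1) := by
      refine Submodule.eq_of_le_of_finrank_eq (Submodule.span_le.2 ?_) ?_
      · rintro _ ⟨a, rfl⟩
        match a with
        | 0 => exact (mk_mem_projLinear_iff _ v hv).1 hpl
        | 1 => exact (mk_mem_projLinear_iff _ w₁ hw₁).1 hq₁l
      · rw [finrank_span_eq_card hli, finrank_span_eq_card u.2]
    obtain ⟨a, b, hab⟩ : ∃ a b : K, a • v + b • w₁ = w₂ :=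
      mem_span_range_fin_two.1 (hspan ▸ (mk_mem_projLinear_iff _ w₂ hw₂).1 hq₂l)
    have ha : a ≠ 0 := by
      rintro rfl
      have hb : b ≠ 0 := fun h => hw₂ (by rw [← hab, h, zero_smul, zero_smul, add_zero])
      exact hq ⟨b⁻¹, by rw [← hab, zero_smul, zero_add, inv_smul_smul₀ hb]⟩
    have hb : b ≠ 0 := by
      rintro rfl
      exact hpq₂ ⟨a⁻¹, by rw [← hab, zero_smul, add_zero, inv_smul_smul₀ ha]⟩
    have hli' : LinearIndependent K ![a • v, b • w₁] := by
      refine linearIndependent_fin_two.2 fun s t h => ?_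
      have := linearIndependent_fin_two.1 hli (s * a) (t * b) (by
        simpa [smul_smul] using h)
      simpa [ha, hb] using this
    refine ⟨⟨_, hli'⟩, ⟨⟨smul_ne_zero ha hv, ?_⟩, ⟨smul_ne_zero hb hw₁, ?_⟩, ?_⟩, ?_⟩
    · convert hp using 1
      exact (Projectivization.mk_eq_mk_iff' ..).2 ⟨a, rfl⟩
    · convert hq₁ using 1
      exact (Projectivization.mk_eq_mk_iff' ..).2 ⟨b, rfl⟩
    · subst hab
      exact ⟨hw₂, hq₂⟩
    · refine lineOf_eq_iff.2 (Eq.trans ?_ hspan)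
      refine Submodule.eq_of_le_of_finrank_eq (Submodule.span_le.2 ?_) ?_
      · rintro _ ⟨c, rfl⟩
        match c with
        | 0 => exact Submodule.smul_mem _ _ (Submodule.subset_span ⟨0, rfl⟩)
        | 1 => exact Submodule.smul_mem _ _ (Submodule.subset_span ⟨1, rfl⟩)
      · rw [finrank_span_eq_card hli', finrank_span_eq_card hli]
  · rintro ⟨u, ⟨⟨hv, hp⟩, ⟨hw, hq₁⟩, ⟨hvw, hq₂⟩⟩, rfl⟩
    refine ⟨_, hp, _, hq₁, _, hq₂, ?_, (mk_mem_lineOf_iff u _).2 ⟨1, 0, ?_⟩,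
      (mk_mem_lineOf_iff u _).2 ⟨0, 1, ?_⟩, (mk_mem_lineOf_iff u _).2 ⟨1, 1, ?_⟩⟩
    · rw [Ne, Projectivization.mk_eq_mk_iff']
      rintro ⟨a, ha⟩
      have := linearIndependent_fin_two.1 u.2 a (a - 1) (by
        rw [sub_smul, one_smul, ← add_sub_assoc, ← smul_add, ha, sub_self])
      rw [this.1, zero_sub, neg_eq_zero] at this
      exact one_ne_zero this.2
    all_goals simp only [one_smul, zero_smul, add_zero, zero_add]

/-- A component of `V₁,₃(Y,Z)` is spanned by an irreducible family of pairs of points. -/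
theorem IsIrredCompOf.exists_isIrreducible_trisecantPairs {K : Type} [Field K] {r : ℕ}
    {Y Z : Set (Pn K r)} {S : Set (Grass K r)} (hS : IsIrredCompOf S (trisecantsRel K Y Z)) :
    ∃ 𝒰 ⊆ trisecantPairs Y Z, IsIrreducible 𝒰 ∧ S = closure (lineOf K '' 𝒰) := by
  classical
  rw [trisecantsRel_eq_closure] at hS
  obtain ⟨hSsub, hSirr, -, hSmax⟩ := hS
  have := ((isZariskiAlong_stiefel2 K r).comp_isInducing
    (Topology.IsInducing.subtypeVal (t := trisecantPairs Y Z))).noetherianSpace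
  obtain ⟨𝒞, h𝒞, -, hirr, hcover⟩ :=
    TopologicalSpace.NoetherianSpace.exists_finite_set_isClosed_irreducible
      (isClosed_univ (X := trisecantPairs Y Z))
  let φ (t : Set (trisecantPairs Y Z)) : Set (Grass K r) :=
    closure (lineOf K '' (Subtype.val '' t))
  obtain ⟨_, ht, hSt⟩ := isIrreducible_iff_sUnion_isClosed.1 hSirr (h𝒞.toFinset.image φ) (by
    simp only [Finset.mem_image]
    rintro _ ⟨t, -, rfl⟩
    exact isClosed_closure) (by
    refine hSsub.trans (closure_minimal ?_ ?_)
    · rintro _ ⟨u, hu, rfl⟩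
      obtain ⟨t, ht, hut⟩ : ∃ t ∈ 𝒞, (⟨u, hu⟩ : trisecantPairs Y Z) ∈ t :=
        Set.mem_sUnion.1 (hcover ▸ Set.mem_univ _)
      exact ⟨φ t, by simpa using ⟨t, ht, rfl⟩, subset_closure ⟨u, ⟨_, hut, rfl⟩, rfl⟩⟩
    · rw [Set.sUnion_eq_biUnion]
      refine (Finset.finite_toSet _).isClosed_biUnion ?_
      simp only [Finset.coe_image]
      rintro _ ⟨t, -, rfl⟩
      exact isClosed_closure)
  simp only [Finset.mem_image, Set.Finite.mem_toFinset] at ht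
  obtain ⟨t, ht, rfl⟩ := ht
  have h𝒰 : IsIrreducible (Subtype.val '' t) :=
    (hirr t ht).image _ continuous_subtype_val.continuousOn
  have hsub : Subtype.val '' t ⊆ trisecantPairs Y Z := Subtype.coe_image_subset _ t
  exact ⟨_, hsub, h𝒰, (hSmax _ hSt (closure_mono (Set.image_mono hsub))
    (h𝒰.image _ NormalPair.continuous_lineOf.continuousOn).closure isClosed_closure).symm⟩

/-- **Trisecant-lemma paper, remark after Theorem 11.** Let `Z ⊆ ℙʳ` be a closed variety of
dimension `n` (possibly singular, reducible or non-equidimensional), `Y ⊆ Z` a proper closed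
subvariety of dimension `k ≥ 1`, and `S` an irreducible component of maximal dimension of
`V₁,₃(Y,Z)`. If `r > n + 1` and `dim S = n + k`, then the union of the lines of `S` does not
cover `ℙʳ`. -/
theorem linesUnion_ne_univ_of_max_dim
    (K : Type) [Field K] [IsAlgClosed K] [CharZero K]
    (n k r : ℕ) (hr : n + 1 < r) (hk : 1 ≤ k)
    (Z Y : Set (Pn K r))
    (hZcl : IsClosed Z) (hZdim : sdim Z = (n : WithBot ℕ∞))
    (hYcl : IsClosed Y) (hYsub : Y ⊆ Z) (hYproper : Y ≠ Z)
    (hYdim : sdim Y = (k : WithBot ℕ∞))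
    (S : Set (Grass K r))
    (hScomp : IsIrredCompOf S (trisecantsRel K Y Z))
    (hSmax : ∀ C : Set (Grass K r), IsIrredCompOf C (trisecantsRel K Y Z) →
      sdim C ≤ sdim S)
    (hSdim : sdim S = ((n + k : ℕ) : WithBot ℕ∞)) :
    linesUnion K S ≠ Set.univ := by
  obtain ⟨𝒰, h𝒰sub, h𝒰, rfl⟩ := hScomp.exists_isIrreducible_trisecantPairs
  obtain ⟨L, _, _, x, hx⟩ := exists_isGenericPair h𝒰
  have hb : AlgebraicIndependent L fun a : Fin 2 =>
      algebraMap (MvPolynomial (Fin 2) L) (FractionRing (MvPolynomial (Fin 2) L)) (X a) :=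
    (MvPolynomial.algebraicIndependent_X (Fin 2) L).map'
      (f := IsScalarTower.toAlgHom L _ (FractionRing (MvPolynomial (Fin 2) L)))
      (IsFractionRing.injective _ _)
  obtain ⟨F, hF0, hF⟩ := hx.exists_form hb h𝒰.nonempty hr hZcl hZdim.le hYcl hYdim.le
    (fun u hu => (h𝒰sub hu).1)
    (fun u hu => (h𝒰sub hu).2.1.imp fun _ h => h.1)
    (fun u hu => (h𝒰sub hu).2.2.imp fun _ h => h.1) hSdim.ge
  exact linesUnion_ne_univ_of_form h𝒰.nonempty hF0 hF
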